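/- The cross product of the partial derivatives of the evolutoid at the origin is ∂_u E₁(0,0) × ∂_v E₁(0,0) = (0, a₀₃·(sin²(α)·κ₂ − κ₁)/(sin²(α)·κ₂³), 0). -/

import Mathlib

noncomputable section

open Real

def dot3 (a b : Fin 3 → ℝ) : ℝ := a 0 * b 0 + a 1 * b 1 + a 2 * b 2

def cross3 (a b : Fin 3 → ℝ) : Fin 3 → ℝ :=
  ![a 1 * b 2 - a 2 * b 1, a 2 * b 0 - a 0 * b 2, a 0 * b 1 - a 1 * b 0]

def norm3 (a : Fin 3 → ℝ) : ℝ := Real.sqrt (dot3 a a)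

noncomputable def pdu {X : Type*} [NormedAddCommGroup X] [NormedSpace ℝ X]
    (f : ℝ × ℝ → X) : ℝ × ℝ → X := fun p => deriv (fun t => f (t, p.2)) p.1

noncomputable def pdv {X : Type*} [NormedAddCommGroup X] [NormedSpace ℝ X]
    (f : ℝ × ℝ → X) : ℝ × ℝ → X := fun p => deriv (fun t => f (p.1, t)) p.2

noncomputable def pd (i j : ℕ) (f : ℝ × ℝ → ℝ) : ℝ × ℝ → ℝ :=
  (pdu (X := ℝ))^[i] ((pdv (X := ℝ))^[j] f)

def mongeSurf (f : ℝ × ℝ → ℝ) : ℝ × ℝ → Fin 3 → ℝ := fun p => ![p.1, p.2, f p]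

noncomputable def unitNormal (ψ : ℝ × ℝ → Fin 3 → ℝ) : ℝ × ℝ → Fin 3 → ℝ := fun p =>
  (norm3 (cross3 (pdu ψ p) (pdv ψ p)))⁻¹ • cross3 (pdu ψ p) (pdv ψ p)

noncomputable def coefE (f : ℝ × ℝ → ℝ) : ℝ × ℝ → ℝ := fun p => 1 + (pdu f p) ^ 2
noncomputable def coefG (f : ℝ × ℝ → ℝ) : ℝ × ℝ → ℝ := fun p => 1 + (pdv f p) ^ 2

noncomputable def kap2 (f : ℝ × ℝ → ℝ) : ℝ × ℝ → ℝ := fun p =>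
  dot3 (pdv (pdv (mongeSurf f)) p) (unitNormal (mongeSurf f) p) / coefG f p

noncomputable def rfun (α : ℝ) (f : ℝ × ℝ → ℝ) : ℝ × ℝ → ℝ := fun p =>
  -(2 * Real.sqrt (coefE f p) * coefG f p) /
    (Real.cos α * pdu (coefG f) p -
      2 * Real.sin α * Real.sqrt (coefE f p) * coefG f p * kap2 f p)

noncomputable def evolutoid (α : ℝ) (f : ℝ × ℝ → ℝ) : ℝ × ℝ → Fin 3 → ℝ := fun p =>
  mongeSurf f p +
    rfun α f p •
      ((Real.cos α / Real.sqrt (coefE f p)) • pdu (mongeSurf f) p +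
        Real.sin α • unitNormal (mongeSurf f) p)

def MongeHyp (κ₁ κ₂ : ℝ) (a : ℕ → ℕ → ℝ) (f : ℝ × ℝ → ℝ) : Prop :=
  ContDiff ℝ (⊤ : ℕ∞) f ∧ f (0, 0) = 0 ∧
    pdu f (0, 0) = 0 ∧ pdv f (0, 0) = 0 ∧
    pd 2 0 f (0, 0) = κ₁ ∧ pd 1 1 f (0, 0) = 0 ∧ pd 0 2 f (0, 0) = κ₂ ∧
    ∀ i j : ℕ, 3 ≤ i + j → i + j ≤ 4 → pd i j f (0, 0) = a i j

noncomputable def gaussK (ψ : ℝ × ℝ → Fin 3 → ℝ) : ℝ × ℝ → ℝ := fun p =>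
  (dot3 (pdu (pdu ψ) p) (unitNormal ψ p) * dot3 (pdv (pdv ψ) p) (unitNormal ψ p) -
      dot3 (pdu (pdv ψ) p) (unitNormal ψ p) ^ 2) /
    (norm3 (pdu ψ p) ^ 2 * norm3 (pdv ψ p) ^ 2 - (dot3 (pdu ψ p) (pdv ψ p)) ^ 2)

def AEquivalentAt {E F : Type*} [NormedAddCommGroup E] [NormedSpace ℝ E]
    [NormedAddCommGroup F] [NormedSpace ℝ F]
    (f : E → F) (p : E) (g : E → F) (q : E) : Prop :=
  ∃ (h : PartialHomeomorph E E) (ξ : PartialHomeomorph F F),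
    p ∈ h.source ∧ h p = q ∧
    ContDiffOn ℝ (⊤ : ℕ∞) h h.source ∧ ContDiffOn ℝ (⊤ : ℕ∞) h.symm h.target ∧
    f p ∈ ξ.source ∧ ξ (f p) = g q ∧
    ContDiffOn ℝ (⊤ : ℕ∞) ξ ξ.source ∧ ContDiffOn ℝ (⊤ : ℕ∞) ξ.symm ξ.target ∧
    ∀ᶠ x in nhds p, ξ (f x) = g (h x)

section PartialDerivatives

variable {f : ℝ × ℝ → ℝ}

theorem hasDerivAt_fst_slice (hf : Differentiable ℝ f) (x y : ℝ) :
    HasDerivAt (fun t => f (t, y)) (fderiv ℝ f (x, y) (1, 0)) x :=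
  (hf (x, y)).hasFDerivAt.comp_hasDerivAt x
    ((hasDerivAt_id x).prodMk (hasDerivAt_const x y))

theorem hasDerivAt_snd_slice (hf : Differentiable ℝ f) (x y : ℝ) :
    HasDerivAt (fun t => f (x, t)) (fderiv ℝ f (x, y) (0, 1)) y :=
  (hf (x, y)).hasFDerivAt.comp_hasDerivAt y
    ((hasDerivAt_const y x).prodMk (hasDerivAt_id y))

theorem pdu_eq_fderiv (hf : Differentiable ℝ f) : pdu f = fun p => fderiv ℝ f p (1, 0) :=
  funext fun p => (hasDerivAt_fst_slice hf p.1 p.2).deriv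

theorem pdv_eq_fderiv (hf : Differentiable ℝ f) : pdv f = fun p => fderiv ℝ f p (0, 1) :=
  funext fun p => (hasDerivAt_snd_slice hf p.1 p.2).deriv

theorem hasDerivAt_pdu (hf : Differentiable ℝ f) (x y : ℝ) :
    HasDerivAt (fun t => f (t, y)) (pdu f (x, y)) x := by
  rw [pdu_eq_fderiv hf]
  exact hasDerivAt_fst_slice hf x y

theorem hasDerivAt_pdv (hf : Differentiable ℝ f) (x y : ℝ) :
    HasDerivAt (fun t => f (x, t)) (pdv f (x, y)) y := by
  rw [pdv_eq_fderiv hf]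
  exact hasDerivAt_snd_slice hf x y

theorem contDiff_pdu (hf : ContDiff ℝ (⊤ : ℕ∞) f) : ContDiff ℝ (⊤ : ℕ∞) (pdu f) := by
  rw [pdu_eq_fderiv (hf.differentiable (by simp))]
  exact (hf.fderiv_right (by simp)).clm_apply contDiff_const

theorem contDiff_pdv (hf : ContDiff ℝ (⊤ : ℕ∞) f) : ContDiff ℝ (⊤ : ℕ∞) (pdv f) := by
  rw [pdv_eq_fderiv (hf.differentiable (by simp))]
  exact (hf.fderiv_right (by simp)).clm_apply contDiff_const

theorem pdv_pdu_eq_pdu_pdv (hf : ContDiff ℝ (⊤ : ℕ∞) f) : pdv (pdu f) = pdu (pdv f) := by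
  have hd : Differentiable ℝ f := hf.differentiable (by simp)
  have hd2 : Differentiable ℝ (fderiv ℝ f) :=
    (hf.fderiv_right (m := (⊤ : ℕ∞)) (by simp)).differentiable (by simp)
  rw [pdv_eq_fderiv ((contDiff_pdu hf).differentiable (by simp)),
    pdu_eq_fderiv ((contDiff_pdv hf).differentiable (by simp)),
    pdu_eq_fderiv hd, pdv_eq_fderiv hd]
  funext p
  rw [fderiv_clm_apply (hd2 p) (differentiableAt_const _),
    fderiv_clm_apply (hd2 p) (differentiableAt_const _)]
  have hsymm : IsSymmSndFDerivAt ℝ f p :=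
    hf.contDiffAt.isSymmSndFDerivAt (by
      rw [minSmoothness_of_isRCLikeNormedField]
      exact WithTop.coe_le_coe.2 le_top)
  simpa using hsymm.eq (0, 1) (1, 0)

end PartialDerivatives

section MongeForm

variable {f : ℝ × ℝ → ℝ}

theorem hasDerivAt_vec3 {x y z : ℝ → ℝ} {x' y' z' t : ℝ} (hx : HasDerivAt x x' t)
    (hy : HasDerivAt y y' t) (hz : HasDerivAt z z' t) :
    HasDerivAt (fun s => ![x s, y s, z s]) ![x', y', z'] t := by
  rw [hasDerivAt_pi]
  intro i
  fin_cases i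
  exacts [hx, hy, hz]

theorem pdu_mongeSurf (hf : Differentiable ℝ f) :
    pdu (mongeSurf f) = fun p => ![1, 0, pdu f p] :=
  funext fun p => (hasDerivAt_vec3 (hasDerivAt_id p.1) (hasDerivAt_const p.1 p.2)
    (hasDerivAt_pdu hf p.1 p.2)).deriv

theorem pdv_mongeSurf (hf : Differentiable ℝ f) :
    pdv (mongeSurf f) = fun p => ![0, 1, pdv f p] :=
  funext fun p => (hasDerivAt_vec3 (hasDerivAt_const p.2 p.1) (hasDerivAt_id p.2)
    (hasDerivAt_pdv hf p.1 p.2)).deriv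

theorem pdv_pdv_mongeSurf (hf : Differentiable ℝ f) (hfv : Differentiable ℝ (pdv f)) :
    pdv (pdv (mongeSurf f)) = fun p => ![0, 0, pdv (pdv f) p] := by
  rw [pdv_mongeSurf hf]
  exact funext fun p => (hasDerivAt_vec3 (hasDerivAt_const p.2 0) (hasDerivAt_const p.2 1)
    (hasDerivAt_pdv hfv p.1 p.2)).deriv

theorem unitNormal_mongeSurf (hf : Differentiable ℝ f) (p : ℝ × ℝ) :
    unitNormal (mongeSurf f) p =
      (√(pdu f p ^ 2 + pdv f p ^ 2 + 1))⁻¹ • ![-pdu f p, -pdv f p, 1] := by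
  simp [unitNormal, pdu_mongeSurf hf, pdv_mongeSurf hf, norm3, cross3, dot3, sq]

theorem pdu_coefG (hfv : Differentiable ℝ (pdv f)) (p : ℝ × ℝ) :
    pdu (coefG f) p = 2 * pdv f p * pdu (pdv f) p := by
  have h := ((hasDerivAt_pdu hfv p.1 p.2).pow 2).const_add 1
  simpa [pdu, coefG] using h.deriv

theorem kap2_eq (hf : Differentiable ℝ f) (hfv : Differentiable ℝ (pdv f)) (p : ℝ × ℝ) :
    kap2 f p = pdv (pdv f) p * (√(pdu f p ^ 2 + pdv f p ^ 2 + 1))⁻¹ / (1 + pdv f p ^ 2) := by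
  simp [kap2, unitNormal_mongeSurf hf, pdv_pdv_mongeSurf hf hfv, dot3, coefG]

/-- The evolutoid radius as a function of the values `P`, `Q`, `M`, `R` of
`f_u`, `f_v`, `f_uv`, `f_vv`. -/
def jetRadius (α P Q M R : ℝ) : ℝ :=
  -(2 * √(1 + P ^ 2) * (1 + Q ^ 2)) /
    (cos α * (2 * Q * M) -
      2 * sin α * √(1 + P ^ 2) * (1 + Q ^ 2) * (R * (√(P ^ 2 + Q ^ 2 + 1))⁻¹ / (1 + Q ^ 2)))

theorem evolutoid_eq (α : ℝ) (hf : Differentiable ℝ f) (hfv : Differentiable ℝ (pdv f))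
    (p : ℝ × ℝ) :
    evolutoid α f p =
      ![p.1 + jetRadius α (pdu f p) (pdv f p) (pdu (pdv f) p) (pdv (pdv f) p) *
          (cos α / √(1 + pdu f p ^ 2) -
            sin α * ((√(pdu f p ^ 2 + pdv f p ^ 2 + 1))⁻¹ * pdu f p)),
        p.2 - jetRadius α (pdu f p) (pdv f p) (pdu (pdv f) p) (pdv (pdv f) p) *
          (sin α * ((√(pdu f p ^ 2 + pdv f p ^ 2 + 1))⁻¹ * pdv f p)),
        f p + jetRadius α (pdu f p) (pdv f p) (pdu (pdv f) p) (pdv (pdv f) p) *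
          (cos α / √(1 + pdu f p ^ 2) * pdu f p +
            sin α * (√(pdu f p ^ 2 + pdv f p ^ 2 + 1))⁻¹)] := by
  have hr : rfun α f p =
      jetRadius α (pdu f p) (pdv f p) (pdu (pdv f) p) (pdv (pdv f) p) := by
    rw [rfun, pdu_coefG hfv, kap2_eq hf hfv, jetRadius, mul_assoc 2 (pdv f p)]
    rfl
  rw [evolutoid, unitNormal_mongeSurf hf, hr, pdu_mongeSurf hf]
  ext i
  fin_cases i
  · simp [mongeSurf, coefE, sub_eq_add_neg]
  · simp [mongeSurf, sub_eq_add_neg]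
  · simp [mongeSurf, coefE]

theorem hasDerivAt_sqrt_one_of_deriv_zero {g : ℝ → ℝ} {t : ℝ} (hg : HasDerivAt g 0 t)
    (h1 : g t = 1) : HasDerivAt (fun s => √(g s)) 0 t := by
  simpa using hg.sqrt (by simp [h1])

theorem hasDerivAt_jetRadius {α κ : ℝ} {P Q M R : ℝ → ℝ} {p' q' m' r' : ℝ}
    (hα : sin α ≠ 0) (hκ : κ ≠ 0)
    (hP : HasDerivAt P p' 0) (hQ : HasDerivAt Q q' 0) (hM : HasDerivAt M m' 0)
    (hR : HasDerivAt R r' 0) (hP0 : P 0 = 0) (hQ0 : Q 0 = 0) (hM0 : M 0 = 0) (hR0 : R 0 = κ) :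
    HasDerivAt (fun t => jetRadius α (P t) (Q t) (M t) (R t)) (-r' / (sin α * κ ^ 2)) 0 := by
  have hE : HasDerivAt (fun t => √(1 + P t ^ 2)) 0 0 :=
    hasDerivAt_sqrt_one_of_deriv_zero (by simpa [hP0] using (hP.pow 2).const_add 1)
      (by simp [hP0])
  have hG : HasDerivAt (fun t => 1 + Q t ^ 2) 0 0 := by
    simpa [hQ0] using (hQ.pow 2).const_add 1
  have hW : HasDerivAt (fun t => √(P t ^ 2 + Q t ^ 2 + 1)) 0 0 :=
    hasDerivAt_sqrt_one_of_deriv_zero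
      (by simpa [hP0, hQ0] using ((hP.pow 2).add (hQ.pow 2)).add_const 1) (by simp [hP0, hQ0])
  have hnum := ((hE.const_mul 2).mul hG).neg
  have hden := (((hQ.const_mul 2).mul hM).const_mul (cos α)).sub
    (((hE.const_mul (2 * sin α)).mul hG).mul ((hR.mul (hW.inv (by simp [hP0, hQ0]))).div hG
      (by simp [hQ0])))
  refine (hnum.div hden (by simp [hP0, hQ0, hR0, hα, hκ])).congr_deriv ?_
  simp [hP0, hQ0, hM0, hR0]
  field_simp

theorem hasDerivAt_evolutoid_curve {α κ : ℝ} {γ : ℝ → ℝ × ℝ} {x' y' z' p' q' m' r' : ℝ}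
    (hf : Differentiable ℝ f) (hfv : Differentiable ℝ (pdv f))
    (hα : sin α ≠ 0) (hκ : κ ≠ 0)
    (hx : HasDerivAt (fun t => (γ t).1) x' 0) (hy : HasDerivAt (fun t => (γ t).2) y' 0)
    (hz : HasDerivAt (fun t => f (γ t)) z' 0)
    (hP : HasDerivAt (fun t => pdu f (γ t)) p' 0) (hQ : HasDerivAt (fun t => pdv f (γ t)) q' 0)
    (hM : HasDerivAt (fun t => pdu (pdv f) (γ t)) m' 0)
    (hR : HasDerivAt (fun t => pdv (pdv f) (γ t)) r' 0)
    (hP0 : pdu f (γ 0) = 0) (hQ0 : pdv f (γ 0) = 0) (hM0 : pdu (pdv f) (γ 0) = 0)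
    (hR0 : pdv (pdv f) (γ 0) = κ) :
    HasDerivAt (fun t => evolutoid α f (γ t))
      ![x' - r' * cos α / (sin α * κ ^ 2) - p' / κ, y' - q' / κ,
        z' - r' / κ ^ 2 + cos α * p' / (sin α * κ)] 0 := by
  simp only [evolutoid_eq α hf hfv]
  have hr := hasDerivAt_jetRadius hα hκ hP hQ hM hR hP0 hQ0 hM0 hR0
  have hE : HasDerivAt (fun t => √(1 + pdu f (γ t) ^ 2)) 0 0 :=
    hasDerivAt_sqrt_one_of_deriv_zero (by simpa [hP0] using (hP.pow 2).const_add 1)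
      (by simp [hP0])
  have hW : HasDerivAt (fun t => √(pdu f (γ t) ^ 2 + pdv f (γ t) ^ 2 + 1)) 0 0 :=
    hasDerivAt_sqrt_one_of_deriv_zero
      (by simpa [hP0, hQ0] using ((hP.pow 2).add (hQ.pow 2)).add_const 1) (by simp [hP0, hQ0])
  have hWinv := hW.inv (by simp [hP0, hQ0])
  have hc := (hasDerivAt_const (0 : ℝ) (cos α)).div hE (by simp [hP0])
  refine hasDerivAt_vec3
    ((hx.add (hr.mul (hc.sub ((hWinv.mul hP).const_mul (sin α))))).congr_deriv ?_)
    ((hy.sub (hr.mul ((hWinv.mul hQ).const_mul (sin α)))).congr_deriv ?_)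
    ((hz.add (hr.mul ((hc.mul hP).add (hWinv.const_mul (sin α))))).congr_deriv ?_) <;>
  · simp [jetRadius, hP0, hQ0, hM0, hR0]
    field_simp
    try ring

end MongeForm

theorem evolutoid_cross_product_at_origin
    (α κ₁ κ₂ : ℝ) (a : ℕ → ℕ → ℝ) (f : ℝ × ℝ → ℝ)
    (hα : α ∈ Set.Ioo 0 (Real.pi / 2))
    (hκ : κ₂ < κ₁) (hκ₁ : κ₁ ≠ 0) (hκ₂ : κ₂ ≠ 0)
    (hf : MongeHyp κ₁ κ₂ a f) :
    cross3 (pdu (evolutoid α f) (0, 0)) (pdv (evolutoid α f) (0, 0)) =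
      ![0, a 0 3 * (Real.sin α ^ 2 * κ₂ - κ₁) / (Real.sin α ^ 2 * κ₂ ^ 3), 0] := by
  obtain ⟨hsm, -, hu, hv, huu, huv, hvv, ha⟩ := hf
  have hs : sin α ≠ 0 := (sin_pos_of_pos_of_lt_pi hα.1 (by linarith [hα.2, pi_pos])).ne'
  have huv' : pdv (pdu f) (0, 0) = 0 := (congrFun (pdv_pdu_eq_pdu_pdv hsm) _).trans huv
  have hvvv : pdv (pdv (pdv f)) (0, 0) = a 0 3 := ha 0 3 (by norm_num) (by norm_num)
  change pdu (pdu f) (0, 0) = κ₁ at huu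
  change pdu (pdv f) (0, 0) = 0 at huv
  change pdv (pdv f) (0, 0) = κ₂ at hvv
  have hd {g : ℝ × ℝ → ℝ} (hg : ContDiff ℝ (⊤ : ℕ∞) g) : Differentiable ℝ g :=
    hg.differentiable (by simp)
  have hdf := hd hsm
  have hdu := hd (contDiff_pdu hsm)
  have hdv := hd (contDiff_pdv hsm)
  have hduv := hd (contDiff_pdu (contDiff_pdv hsm))
  have hdvv := hd (contDiff_pdv (contDiff_pdv hsm))
  have hU : pdu (evolutoid α f) (0, 0) = _ :=
    (hasDerivAt_evolutoid_curve (γ := fun t => (t, 0)) hdf hdv hs hκ₂ (hasDerivAt_id 0)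
      (hasDerivAt_const 0 0) (hasDerivAt_pdu hdf 0 0) (hasDerivAt_pdu hdu 0 0)
      (hasDerivAt_pdu hdv 0 0) (hasDerivAt_pdu hduv 0 0) (hasDerivAt_pdu hdvv 0 0)
      hu hv huv hvv).deriv
  have hV : pdv (evolutoid α f) (0, 0) = _ :=
    (hasDerivAt_evolutoid_curve (γ := fun t => (0, t)) hdf hdv hs hκ₂ (hasDerivAt_const 0 0)
      (hasDerivAt_id 0) (hasDerivAt_pdv hdf 0 0) (hasDerivAt_pdv hdu 0 0)
      (hasDerivAt_pdv hdv 0 0) (hasDerivAt_pdv hduv 0 0) (hasDerivAt_pdv hdvv 0 0)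
      hu hv huv hvv).deriv
  rw [hU, hV, hu, hv, huu, huv, huv', hvv, hvvv]
  ext i
  fin_cases i
  · simp [cross3, hκ₂]
  · simp [cross3]
    field_simp
    linear_combination -(a 0 3) * κ₁ * κ₂ * sin_sq_add_cos_sq α
  · simp [cross3, hκ₂]
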